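/- arXiv:1105.5774 — 2 statements merged into one kernel-verified Lean document; each statement's English description precedes it below -/
import Mathlib

section
/- Fix a real parameter ε < 0 and a real z ≠ 0 such that 1 − 2z³ − (ε⁴/3888)z⁴ + z⁶ ≥ 0, and set λ(z) = (1 + w(z))/(2z³) − 1/2. Let U ⊆ {x ∈ ℝ : x > 0} be an open set on which κ(x,z) ≠ 0. If f : ℝ → ℝ is infinitely differentiable on U and satisfies the third-order equation f‴(x) = χ₂(x,z)·f″(x) + χ₁(x,z)·f′(x) + χ₀(x,z)·f(x) for all x ∈ U, then (L₁f)(x) = λ(z)·f(x) for all x ∈ U. -/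
/-- κ(x,z) = (ε² + x³)z³ − x³ -/
noncomputable def kappa (ε x z : ℝ) : ℝ := (ε ^ 2 + x ^ 3) * z ^ 3 - x ^ 3

/-- w(z) = √(1 − 2z³ − (ε⁴/3888)z⁴ + z⁶) -/
noncomputable def wfun (ε z : ℝ) : ℝ :=
  Real.sqrt (1 - 2 * z ^ 3 - (ε ^ 4 / 3888) * z ^ 4 + z ^ 6)

/-- χ₀(x,z) from Corollary 2.3. -/
noncomputable def chi0 (ε x z : ℝ) : ℝ :=
  1 / (2 * z) - x ^ 3 * (ε ^ 2 + x ^ 3) / 5832 + 10 * (z ^ 3 - 1) / kappa ε x z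
    + ε ^ 2 * x ^ 3 * z / (216 * kappa ε x z)
    - (108 * wfun ε z + ε ^ 2 * z ^ 2) / (6 * kappa ε x z)
    - x ^ 3 * wfun ε z / (2 * kappa ε x z * z)
    + 16 * ε ^ 2 * z ^ 3 / (kappa ε x z * x ^ 3)

/-- χ₁(x,z) from Corollary 2.3. -/
noncomputable def chi1 (ε x z : ℝ) : ℝ :=
  (132 * ε ^ 2 * z ^ 3
      - x ^ 3 * (204 - 204 * z ^ 3 + 108 * wfun ε z + ε ^ 2 * z ^ 2))
    / (12 * x ^ 2 * kappa ε x z)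

/-- χ₂(x,z) from Corollary 2.3. -/
noncomputable def chi2 (ε x z : ℝ) : ℝ := -3 * ε ^ 2 * z ^ 3 / (x * kappa ε x z)

/-- Coefficients of the 9th-order operator L₁ (equation (2.18) of the paper). -/
noncomputable def fcoef7 (ε x : ℝ) : ℝ := -78 / x ^ 2

noncomputable def fcoef6 (ε x : ℝ) : ℝ :=
  384 / x ^ 3 + ε ^ 2 * x ^ 3 / 1944 + x ^ 6 / 1944

noncomputable def fcoef5 (ε x : ℝ) : ℝ :=
  -24 / x ^ 4 + ε ^ 2 * x ^ 2 / 216 + x ^ 5 / 108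

noncomputable def fcoef4 (ε x : ℝ) : ℝ :=
  -4800 / x ^ 5 - 2 * ε ^ 2 * x / 243 + 16 * x ^ 4 / 243

noncomputable def fcoef3 (ε x : ℝ) : ℝ :=
  -143 * ε ^ 2 / 1944 + 19120 / x ^ 6 + 79 * x ^ 3 / 486
    + ε ^ 4 * x ^ 6 / 11337408 + ε ^ 2 * x ^ 9 / 5668704 + x ^ 12 / 11337408

noncomputable def fcoef2 (ε x : ℝ) : ℝ :=
  -43200 / x ^ 7 + 26 * ε ^ 2 / (243 * x) - 73 * x ^ 2 / 243
    + ε ^ 4 * x ^ 5 / 1259712 + ε ^ 2 * x ^ 8 / 419904 + x ^ 11 / 629856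

noncomputable def fcoef1 (ε x : ℝ) : ℝ :=
  58240 / x ^ 8 + 55 * ε ^ 2 / (243 * x ^ 2) - 152 * x / 243
    + 5 * ε ^ 4 * x ^ 4 / 5668704 + 2 * ε ^ 2 * x ^ 7 / 177147
    + 17 * x ^ 10 / 1417176

noncomputable def fcoef0 (ε x : ℝ) : ℝ :=
  152 / 243 - 58240 / x ^ 9 - 55 * ε ^ 2 / (243 * x ^ 3)
    - 37 * ε ^ 4 * x ^ 3 / 11337408 + 115 * ε ^ 2 * x ^ 6 / 11337408
    + 37 * x ^ 9 / 1417176 + ε ^ 6 * x ^ 9 / 198359290368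
    + ε ^ 4 * x ^ 12 / 66119763456 + ε ^ 2 * x ^ 15 / 66119763456
    + x ^ 18 / 198359290368

/-- The 9th-order operator L₁ of Theorem 2.4. -/
noncomputable def L1 (ε : ℝ) (f : ℝ → ℝ) (x : ℝ) : ℝ :=
  iteratedDeriv 9 f x
    + fcoef7 ε x * iteratedDeriv 7 f x
    + fcoef6 ε x * iteratedDeriv 6 f x
    + fcoef5 ε x * iteratedDeriv 5 f x
    + fcoef4 ε x * iteratedDeriv 4 f x
    + fcoef3 ε x * iteratedDeriv 3 f x
    + fcoef2 ε x * iteratedDeriv 2 f x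
    + fcoef1 ε x * iteratedDeriv 1 f x
    + fcoef0 ε x * f x

open Polynomial

/-- In the variable `t = x³/18`, the function `xⁿ f⁽ⁿ⁾` is the combination of `f`, `x f'` and `g`
with the polynomial coefficients `a`, `b` and `c`. -/
def HasEulerRep (U : Set ℝ) (f g : ℝ → ℝ) (n : ℕ) (a b c : ℝ[X]) : Prop :=
  ∀ x ∈ U, x ^ n * iteratedDeriv n f x =
    a.eval (x ^ 3 / 18) * f x + b.eval (x ^ 3 / 18) * (x * deriv f x) + c.eval (x ^ 3 / 18) * g x

theorem differentiableAt_iteratedDeriv_of_isOpen {U : Set ℝ} {f : ℝ → ℝ} (hU : IsOpen U)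
    (hf : ContDiffOn ℝ (⊤ : ℕ∞) f U) (n : ℕ) {x : ℝ} (hx : x ∈ U) :
    DifferentiableAt ℝ (iteratedDeriv n f) x := by
  have h := hf.differentiableOn_iteratedDerivWithin (m := n)
    (by exact_mod_cast ENat.natCast_lt_top n) hU.uniqueDiffOn
  exact ((h.congr fun y hy => (iteratedDerivWithin_of_isOpen hU hy).symm) x hx).differentiableAt
    (hU.mem_nhds hx)

theorem hasDerivAt_eval_cube (p : ℝ[X]) (x : ℝ) :
    HasDerivAt (fun s : ℝ => p.eval (s ^ 3 / 18))
      (p.derivative.eval (x ^ 3 / 18) * (3 * x ^ 2 / 18)) x := by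
  have h : HasDerivAt (fun s : ℝ => s ^ 3 / 18) (3 * x ^ 2 / 18) x := by
    simpa using (hasDerivAt_pow 3 x).div_const 18
  exact (p.hasDerivAt (x ^ 3 / 18)).comp x h

/-- Applying the Euler operator `x d/dx` to a representation of `xⁿ f⁽ⁿ⁾`. -/
theorem HasEulerRep.euler_deriv {U : Set ℝ} {f g : ℝ → ℝ} {n : ℕ} {a b c : ℝ[X]}
    (h : HasEulerRep U f g n a b c) (hU : IsOpen U) (hf : ContDiffOn ℝ (⊤ : ℕ∞) f U)
    {x : ℝ} (hx : x ∈ U) (hg : DifferentiableAt ℝ g x) :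
    x ^ (n + 1) * iteratedDeriv (n + 1) f x + n * (x ^ n * iteratedDeriv n f x) =
      (3 * X * derivative a).eval (x ^ 3 / 18) * f x
        + (a + b + 3 * X * derivative b).eval (x ^ 3 / 18) * (x * deriv f x)
        + b.eval (x ^ 3 / 18) * (x ^ 2 * iteratedDeriv 2 f x)
        + (3 * X * derivative c).eval (x ^ 3 / 18) * g x
        + c.eval (x ^ 3 / 18) * (x * deriv g x) := by
  have hderiv : ∀ m, HasDerivAt (iteratedDeriv m f) (iteratedDeriv (m + 1) f x) x := fun m => by
    rw [iteratedDeriv_succ]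
    exact (differentiableAt_iteratedDeriv_of_isOpen hU hf m hx).hasDerivAt
  have hf0 : HasDerivAt f (deriv f x) x := by simpa using hderiv 0
  have hf1 : HasDerivAt (deriv f) (iteratedDeriv 2 f x) x := by simpa using hderiv 1
  have hl := (hasDerivAt_pow n x).mul (hderiv n)
  have hr := (((hasDerivAt_eval_cube a x).mul hf0).add
    ((hasDerivAt_eval_cube b x).mul ((hasDerivAt_id x).mul hf1))).add
    ((hasDerivAt_eval_cube c x).mul hg.hasDerivAt)
  have heq := hr.congr_of_eventuallyEq
    (Filter.eventually_of_mem (hU.mem_nhds hx) fun s hs => h s hs)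
  have key := congrArg (x * ·) (hl.unique heq)
  have hpow : x * (n * x ^ (n - 1)) = n * x ^ n := by
    cases n with
    | zero => simp
    | succ k => simp only [Nat.add_sub_cancel]; ring
  simp only [Pi.mul_apply, eval_add, eval_mul, eval_X, eval_ofNat, id] at key ⊢
  linear_combination key - iteratedDeriv n f x * hpow

/-- A third-order linear system for `f`, `x f'` and `g` in the variable `t = x³/18`, free of
singularities away from `x = 0`. -/
structure EulerSystem (U : Set ℝ) (f g : ℝ → ℝ) (y A S e : ℝ) : Prop where
  isOpen : IsOpen U
  contDiffOn : ContDiffOn ℝ (⊤ : ℕ∞) f U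
  differentiableAt : ∀ x ∈ U, DifferentiableAt ℝ g x
  hasEulerRep_two : HasEulerRep U f g 2
    (2 - 2 * C A * X + (C y ^ 2 - C A * C y) * X ^ 2) (-2 - C A * X) (1 + C S * X)
  euler_deriv : ∀ x ∈ U, x * deriv g x =
    ((18 + 9 * y * (x ^ 3 / 18)) * (1 - S * (x ^ 3 / 18)) - e * (x ^ 3 / 18) ^ 2) * f x
      + 9 * (1 - S * (x ^ 3 / 18)) * (x * deriv f x) + (1 + A * (x ^ 3 / 18)) * g x
  rel_A : A ^ 2 = 9 * S ^ 2 - y ^ 2 + A * y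
  rel_e : S * e = 1 - y ^ 3

section EulerSystem

variable {U : Set ℝ} {f g : ℝ → ℝ} {y A S e : ℝ}

theorem EulerSystem.C_rel_A (h : EulerSystem U f g y A S e) :
    (C A : ℝ[X]) ^ 2 = 9 * C S ^ 2 - C y ^ 2 + C A * C y := by
  simpa [map_ofNat C] using congrArg (C : ℝ → ℝ[X]) h.rel_A

theorem EulerSystem.C_rel_e (h : EulerSystem U f g y A S e) :
    (C S : ℝ[X]) * C e = 1 - C y ^ 3 := by
  simpa using congrArg (C : ℝ → ℝ[X]) h.rel_e

/-- A solution of a third-order equation with an apparent singularity at `1 + S t = 0` extends to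
an `EulerSystem`. -/
theorem eulerSystem_of_ode (hU : IsOpen U) (hf : ContDiffOn ℝ (⊤ : ℕ∞) f U)
    (rel_A : A ^ 2 = 9 * S ^ 2 - y ^ 2 + A * y) (rel_e : S * e = 1 - y ^ 3)
    (hK : ∀ x ∈ U, 1 + S * (x ^ 3 / 18) ≠ 0)
    (hode : ∀ x ∈ U, ∀ t, t = x ^ 3 / 18 → (1 + S * t) * (x ^ 3 * iteratedDeriv 3 f x) =
      -3 * (x ^ 2 * iteratedDeriv 2 f x) + (11 + 17 * S * t - 3 * A * t) * (x * deriv f x)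
        + ((1 + S * t) * (9 * y * t - e * t ^ 2 - t ^ 3)
          + 16 + 10 * S * t - 6 * A * t + 3 * (y ^ 2 - A * y) * t ^ 2) * f x)
    (hg : g = fun x => ((10 + 9 * y * (x ^ 3 / 18) - e * (x ^ 3 / 18) ^ 2 - (x ^ 3 / 18) ^ 3) * f x
      + 17 * (x * deriv f x) - x ^ 3 * iteratedDeriv 3 f x) / 3) :
    EulerSystem U f g y A S e := by
  have hrep : HasEulerRep U f g 2
      (2 - 2 * C A * X + (C y ^ 2 - C A * C y) * X ^ 2) (-2 - C A * X) (1 + C S * X) := by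
    intro x hx
    simp only [hg, eval_add, eval_sub, eval_neg, eval_mul, eval_pow, eval_X, eval_C, eval_ofNat,
      eval_one]
    linear_combination (1 / 3) * hode x hx _ rfl
  have hdiff : ∀ x ∈ U, DifferentiableAt ℝ g x := by
    intro x hx
    have h0 := differentiableAt_iteratedDeriv_of_isOpen hU hf 0 hx
    have h1 := differentiableAt_iteratedDeriv_of_isOpen hU hf 1 hx
    have h3 := differentiableAt_iteratedDeriv_of_isOpen hU hf 3 hx
    rw [iteratedDeriv_zero] at h0
    rw [iteratedDeriv_one] at h1
    rw [hg]
    fun_prop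
  refine ⟨hU, hf, hdiff, hrep, fun x hx => mul_left_cancel₀ (hK x hx) ?_, rel_A, rel_e⟩
  have key := hrep.euler_deriv hU hf hx (hdiff x hx)
  have h2 := hrep x hx
  have hgx := congrFun hg x
  simp only [derivative_add, derivative_sub, derivative_neg, derivative_mul, derivative_X,
    derivative_C, derivative_pow, derivative_ofNat, derivative_one, Nat.cast_ofNat,
    eval_add, eval_sub, eval_neg, eval_mul, eval_pow, eval_X, eval_C, eval_ofNat, eval_one,
    eval_zero] at key h2
  generalize x ^ 3 / 18 = t at *
  norm_num at key h2
  linear_combination -key + (4 + A * t) * h2 + 3 * hgx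
    - ((2 * t ^ 2 + t ^ 3 * y) * f x + t ^ 2 * (x * deriv f x)) * rel_A + t ^ 3 * f x * rel_e

theorem EulerSystem.hasEulerRep_succ (h : EulerSystem U f g y A S e) {n : ℕ}
    {a b c a' b' c' : ℝ[X]} (hn : HasEulerRep U f g n a b c)
    (ha : a' = 3 * X * derivative a - (n : ℝ[X]) * a + b * (2 - 2 * C A * X + (C y ^ 2 - C A * C y) * X ^ 2)
      + c * ((18 + 9 * C y * X) * (1 - C S * X) - C e * X ^ 2))
    (hb : b' = a + 3 * X * derivative b - (n : ℝ[X]) * b - b * (1 + C A * X) + 9 * c * (1 - C S * X))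
    (hc : c' = b * (1 + C S * X) + 3 * X * derivative c - (n : ℝ[X]) * c + c * (1 + C A * X)) :
    HasEulerRep U f g (n + 1) a' b' c' := by
  intro x hx
  have key := hn.euler_deriv h.isOpen h.contDiffOn hx (h.differentiableAt x hx)
  have h2 := h.hasEulerRep_two x hx
  have hg := h.euler_deriv x hx
  have h0 := hn x hx
  subst ha hb hc
  simp only [eval_add, eval_sub, eval_neg, eval_mul, eval_pow, eval_X, eval_C, eval_ofNat,
    eval_one, eval_natCast] at key h2 ⊢
  linear_combination key - n * h0 + eval (x ^ 3 / 18) b * h2 + eval (x ^ 3 / 18) c * hg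

set_option linter.unusedSimpArgs false

theorem EulerSystem.hasEulerRep_three (h : EulerSystem U f g y A S e) :
    HasEulerRep U f g 3
      (10 + 9 * X * C y - X ^ 2 * C e - X ^ 3)
      17
      (-3) := by
  refine h.hasEulerRep_succ h.hasEulerRep_two ?_ ?_ ?_ <;>
    simp only [derivative_add, derivative_sub, derivative_neg, derivative_mul, derivative_X,
      derivative_C, derivative_pow, derivative_ofNat, derivative_one, derivative_zero,
      Nat.cast_ofNat, map_ofNat C]
  · linear_combination (-2 * X ^ 2 - X ^ 3 * C y) * h.C_rel_A + (X ^ 3) * h.C_rel_e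
  · linear_combination (-X ^ 2) * h.C_rel_A
  · ring

theorem EulerSystem.hasEulerRep_four (h : EulerSystem U f g y A S e) :
    HasEulerRep U f g 4
      (-50 + (54 * C S - 27 * C y - 34 * C A) * X + (27 * C y * C S + 17 * C y ^ 2 - 17 * C A * C y)
        * X ^ 2 - 6 * X ^ 3)
      (-85 + (27 * C S + 9 * C y - 17 * C A) * X - X ^ 2 * C e - X ^ 3)
      (23 + (17 * C S - 3 * C A) * X) := by
  refine h.hasEulerRep_succ h.hasEulerRep_three ?_ ?_ ?_ <;>
    simp only [derivative_add, derivative_sub, derivative_neg, derivative_mul, derivative_X,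
      derivative_C, derivative_pow, derivative_ofNat, derivative_one, derivative_zero,
      Nat.cast_ofNat, map_ofNat C]
  · ring
  · ring
  · ring

theorem EulerSystem.hasEulerRep_five (h : EulerSystem U f g y A S e) :
    HasEulerRep U f g 5
      (444 - (108 * C S - 252 * C y - 116 * C A) * X - (25 * C e + 85 * C y ^ 2 - 40 * C A * C y) * X ^ 2
        - (49 - 27 * C y ^ 2 * C S - 9 * C y ^ 3 - 5 * C A * C e + 9 * C A * C y ^ 2) * X ^ 3 - (C y ^ 2
        * C e - 2 * C A - C A * C y * C e) * X ^ 4 - (C y ^ 2 - C A * C y) * X ^ 5)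
      (582 - (54 * C S + 45 * C y - 58 * C A) * X - (C e - 27 * C y * C S + 9 * C A * C y) * X ^ 2
        - (10 - C A * C e) * X ^ 3 + X ^ 4 * C A)
      (-154 - (58 * C S - 9 * C y - 6 * C A) * X - (C e - 9 * C y * C S - 3 * C y ^ 2 + 3 * C A * C y)
        * X ^ 2 - (2 - C y ^ 3) * X ^ 3 - X ^ 4 * C S) := by
  refine h.hasEulerRep_succ h.hasEulerRep_four ?_ ?_ ?_ <;>
    simp only [derivative_add, derivative_sub, derivative_neg, derivative_mul, derivative_X,
      derivative_C, derivative_pow, derivative_ofNat, derivative_one, derivative_zero,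
      Nat.cast_ofNat, map_ofNat C]
  · linear_combination (-34 * X ^ 2 - 17 * X ^ 3 * C y) * h.C_rel_A + (17 * X ^ 3) * h.C_rel_e
  · linear_combination (-17 * X ^ 2) * h.C_rel_A
  · linear_combination (3 * X ^ 2) * h.C_rel_A + (X ^ 3) * h.C_rel_e

theorem EulerSystem.hasEulerRep_six (h : EulerSystem U f g y A S e) :
    HasEulerRep U f g 6
      (-3828 + (1836 * C S - 1818 * C y - 1172 * C A) * X + (109 * C e + 918 * C y * C S + 748 * C y ^ 2
        - 586 * C A * C y) * X ^ 2 - (176 + 18 * C y * C e - 18 * C A * C e) * X ^ 3 + (C e ^ 2 - 18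
        * C y - 9 * C y ^ 2 * C e + 36 * C A + 9 * C A * C y * C e) * X ^ 4 + (2 * C e - 18 * C y ^ 2
        + 18 * C A * C y) * X ^ 5 + X ^ 6)
      (-4434 + (918 * C S + 468 * C y - 586 * C A) * X - 34 * X ^ 2 * C e - (88 - 9 * C A * C e) * X ^ 3
        + 18 * X ^ 4 * C A)
      (1198 + (586 * C S - 54 * C y - 102 * C A) * X - 3 * X ^ 2 * C e - (21 - 9 * C y ^ 3) * X ^ 3
        - 18 * X ^ 4 * C S) := by
  refine h.hasEulerRep_succ h.hasEulerRep_five ?_ ?_ ?_ <;>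
    simp only [derivative_add, derivative_sub, derivative_neg, derivative_mul, derivative_X,
      derivative_C, derivative_pow, derivative_ofNat, derivative_one, derivative_zero,
      Nat.cast_ofNat, map_ofNat C]
  · linear_combination (116 * X ^ 2 + 40 * X ^ 3 * C y + (2 * C e - 9 * C y ^ 2) * X ^ 4 + (2 + C y
      * C e) * X ^ 5 + X ^ 6 * C y) * h.C_rel_A + (-76 * X ^ 3 + 18 * X ^ 4 * C S + 9 * X ^ 5 * C y
      * C S - X ^ 6) * h.C_rel_e
  · linear_combination (58 * X ^ 2 - 9 * X ^ 3 * C y + X ^ 4 * C e + X ^ 5) * h.C_rel_A + (-9 * X ^ 3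
      + 9 * X ^ 4 * C S) * h.C_rel_e
  · linear_combination (-6 * X ^ 2 + 3 * X ^ 3 * C y) * h.C_rel_A + (X ^ 3 - X ^ 4 * C A) * h.C_rel_e

set_option maxHeartbeats 2000000 in
theorem EulerSystem.hasEulerRep_seven (h : EulerSystem U f g y A S e) :
    HasEulerRep U f g 7
      (35664 - (14688 * C S - 16200 * C y - 9376 * C A) * X - (1320 * C e + 4536 * C y * C S + 6092
        * C y ^ 2 - 3752 * C A * C y) * X ^ 2 - (1614 + 27 * C y * C e - 1404 * C y ^ 2 * C S - 576
        * C y ^ 3 - 242 * C A * C e + 468 * C A * C y ^ 2) * X ^ 3 + (9 * C e ^ 2 - 108 * C S - 270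
        * C y - 70 * C y ^ 2 * C e + 54 * C y ^ 4 + 428 * C A + 70 * C A * C y * C e) * X ^ 4 + (39
        * C e - 54 * C y * C S - 214 * C y ^ 2 + 214 * C A * C y) * X ^ 5 + 30 * X ^ 6)
      (37992 - (7344 * C S + 4176 * C y - 4688 * C A) * X + (116 * C e + 1404 * C y * C S + 162 * C y ^ 2
        - 468 * C A * C y) * X ^ 2 - (514 + 18 * C y * C e - 54 * C y ^ 3 - 70 * C A * C e) * X ^ 3
        + (C e ^ 2 - 54 * C S - 18 * C y + 214 * C A) * X ^ 4 + 2 * X ^ 5 * C e + X ^ 6)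
      (-10424 - (4688 * C S - 576 * C y - 816 * C A) * X - (37 * C e - 468 * C y * C S - 102 * C y ^ 2
        + 156 * C A * C y) * X ^ 2 - (206 - 70 * C y ^ 3 - 6 * C A * C e) * X ^ 3 - (214 * C S - 6
        * C A) * X ^ 4) := by
  refine h.hasEulerRep_succ h.hasEulerRep_six ?_ ?_ ?_ <;>
    simp only [derivative_add, derivative_sub, derivative_neg, derivative_mul, derivative_X,
      derivative_C, derivative_pow, derivative_ofNat, derivative_one, derivative_zero,
      Nat.cast_ofNat, map_ofNat C]
  · linear_combination (-1172 * X ^ 2 - 586 * X ^ 3 * C y + 18 * X ^ 4 * C e + (36 + 9 * C y * C e)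
      * X ^ 5 + 18 * X ^ 6 * C y) * h.C_rel_A + (532 * X ^ 3 + (162 * C S - 27 * C y) * X ^ 4 + 81
      * X ^ 5 * C y * C S - 18 * X ^ 6) * h.C_rel_e
  · linear_combination (-586 * X ^ 2 + 9 * X ^ 4 * C e + 18 * X ^ 5) * h.C_rel_A + (-27 * X ^ 3 + 81
      * X ^ 4 * C S) * h.C_rel_e
  · linear_combination (102 * X ^ 2) * h.C_rel_A + (34 * X ^ 3 - 9 * X ^ 4 * C A) * h.C_rel_e

set_option maxHeartbeats 2000000 in
theorem EulerSystem.hasEulerRep_eight (h : EulerSystem U f g y A S e) :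
    HasEulerRep U f g 8
      (-361296 + (147312 * C S - 156600 * C y - 89424 * C A) * X + (11310 * C e + 57024 * C y * C S
        + 60804 * C y ^ 2 - 39168 * C A * C y) * X ^ 2 - (2610 + 999 * C y * C e + 7344 * C y ^ 2 * C S
        + 2340 * C y ^ 3 + 316 * C A * C e - 2448 * C A * C y ^ 2) * X ^ 3 + (84 * C e ^ 2 - 2052 * C S
        - 3375 * C y - 196 * C y ^ 2 * C e + 486 * C y ^ 3 * C S + 729 * C y ^ 4 + 3596 * C A + 340
        * C A * C y * C e - 162 * C A * C y ^ 3) * X ^ 4 + (522 * C e - 1134 * C y * C S - 1798 * C y ^ 2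
        - 18 * C y ^ 3 * C e + 54 * C y ^ 5 - 8 * C A * C e ^ 2 + 1834 * C A * C y + 18 * C A * C y ^ 2
        * C e) * X ^ 5 + (546 + C y ^ 2 * C e ^ 2 - 54 * C y ^ 2 * C S - 18 * C y ^ 3 - 10 * C A * C e
        - C A * C y * C e ^ 2 + 18 * C A * C y ^ 2) * X ^ 6 + (2 * C y ^ 2 * C e - 2 * C A - 2 * C A
        * C y * C e) * X ^ 7 + (C y ^ 2 - C A * C y) * X ^ 8)
      (-362088 + (73656 * C S + 42264 * C y - 44712 * C A) * X - (1885 * C e + 8316 * C y * C S + 810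
        * C y ^ 2 - 2772 * C A * C y) * X ^ 2 - (3649 + 45 * C y * C e - 486 * C y ^ 2 * C S - 459
        * C y ^ 3 - 250 * C A * C e + 162 * C A * C y ^ 2) * X ^ 3 + (13 * C e ^ 2 - 1026 * C S - 342
        * C y + 54 * C y ^ 4 + 1798 * C A + 18 * C A * C y * C e) * X ^ 4 + (53 * C e - 54 * C y * C S
        - C A * C e ^ 2 + 18 * C A * C y) * X ^ 5 + (40 - 2 * C A * C e) * X ^ 6 - X ^ 7 * C A)
      (100536 + (44712 * C S - 5904 * C y - 8184 * C A) * X + (116 * C e - 2772 * C y * C S - 654 * C y ^ 2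
        + 924 * C A * C y) * X ^ 2 - (1016 + 18 * C y * C e - 162 * C y ^ 2 * C S - 304 * C y ^ 3 - 51
        * C A * C e + 54 * C A * C y ^ 2) * X ^ 3 + (C e ^ 2 - 1798 * C S - 36 * C y - 6 * C y ^ 2
        * C e + 18 * C y ^ 4 + 114 * C A + 6 * C A * C y * C e) * X ^ 4 + (3 * C e - 18 * C y * C S
        - 6 * C y ^ 2 - C y ^ 3 * C e + 6 * C A * C y) * X ^ 5 + (3 - 2 * C y ^ 3) * X ^ 6 + X ^ 7
        * C S) := by
  refine h.hasEulerRep_succ h.hasEulerRep_seven ?_ ?_ ?_ <;>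
    simp only [derivative_add, derivative_sub, derivative_neg, derivative_mul, derivative_X,
      derivative_C, derivative_pow, derivative_ofNat, derivative_one, derivative_zero,
      Nat.cast_ofNat, map_ofNat C]
  · linear_combination (9376 * X ^ 2 + 3752 * X ^ 3 * C y + (140 * C e - 468 * C y ^ 2) * X ^ 4 + (428
      + 70 * C y * C e) * X ^ 5 + 214 * X ^ 6 * C y) * h.C_rel_A + (-5354 * X ^ 3 + (1260 * C S + 135
      * C y + 108 * C A) * X ^ 4 + (630 * C y * C S + 54 * C A * C y) * X ^ 5 - 214 * X ^ 6) * h.C_rel_e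
  · linear_combination (4688 * X ^ 2 - 468 * X ^ 3 * C y + 70 * X ^ 4 * C e + 214 * X ^ 5) * h.C_rel_A
      + (-333 * X ^ 3 + (630 * C S + 54 * C A) * X ^ 4) * h.C_rel_e
  · linear_combination (-816 * X ^ 2 + 156 * X ^ 3 * C y - 6 * X ^ 4 * C e - 6 * X ^ 5) * h.C_rel_A
      + (-116 * X ^ 3 - (54 * C S - 18 * C y + 70 * C A) * X ^ 4 - X ^ 5 * C e - 2 * X ^ 6) * h.C_rel_e

set_option maxHeartbeats 2000000 in
theorem EulerSystem.hasEulerRep_nine (h : EulerSystem U f g y A S e) :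
    HasEulerRep U f g 9
      (3975840 - (1594080 * C S - 1666080 * C y - 934560 * C A) * X - (124838 * C e + 576720 * C y
        * C S + 639648 * C y ^ 2 - 393840 * C A * C y) * X ^ 2 - (74996 - 5535 * C y * C e - 110160
        * C y ^ 2 * C S - 48060 * C y ^ 3 - 13056 * C A * C e + 36720 * C A * C y ^ 2) * X ^ 3 + (264
        * C e ^ 2 - 28836 * C S - 21924 * C y - 1785 * C y ^ 2 * C e + 5670 * C y ^ 4 + 26412 * C A
        + 2514 * C A * C y * C e) * X ^ 4 + (4812 * C e + 27 * C y * C e ^ 2 - 17334 * C y * C S - 12963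
        * C y ^ 2 - 243 * C y ^ 3 * C e + 729 * C y ^ 5 - 135 * C A * C e ^ 2 + 14178 * C A * C y + 243
        * C A * C y ^ 2 * C e) * X ^ 5 + (7356 - C e ^ 3 + 54 * C y * C e + 27 * C y ^ 2 * C e ^ 2
        - 1458 * C y ^ 2 * C S - 486 * C y ^ 3 - 324 * C A * C e - 27 * C A * C y * C e ^ 2 + 486 * C A
        * C y ^ 2) * X ^ 6 - (3 * C e ^ 2 - 27 * C y - 81 * C y ^ 2 * C e + 108 * C A + 81 * C A * C y
        * C e) * X ^ 7 - (3 * C e - 54 * C y ^ 2 + 54 * C A * C y) * X ^ 8 - X ^ 9)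
      (3802320 - (797040 * C S + 463320 * C y - 467280 * C A) * X + (18009 * C e + 110160 * C y * C S
        + 12636 * C y ^ 2 - 36720 * C A * C y) * X ^ 2 - (12798 + 1161 * C y * C e - 4212 * C y ^ 3
        - 2028 * C A * C e) * X ^ 3 + (132 * C e ^ 2 - 14418 * C S - 4563 * C y + 729 * C y ^ 4 + 13206
        * C A + 243 * C A * C y * C e) * X ^ 4 + (858 * C e - 1458 * C y * C S - 27 * C A * C e ^ 2
        + 486 * C A * C y) * X ^ 5 + (915 - 81 * C A * C e) * X ^ 6 - 54 * X ^ 7 * C A)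
      (-1065840 - (467280 * C S - 65880 * C y - 88560 * C A) * X - (2001 * C e - 36720 * C y * C S
        - 8028 * C y ^ 2 + 12240 * C A * C y) * X ^ 2 - (7566 + 81 * C y * C e - 2028 * C y ^ 3 - 468
        * C A * C e) * X ^ 3 + (18 * C e ^ 2 - 13206 * C S - 567 * C y - 81 * C y ^ 2 * C e + 243 * C y ^ 4
        + 1602 * C A + 81 * C A * C y * C e) * X ^ 4 + (90 * C e - 486 * C y * C S - 162 * C y ^ 2
        - 27 * C y ^ 3 * C e + 162 * C A * C y) * X ^ 5 + (126 - 81 * C y ^ 3) * X ^ 6 + 54 * X ^ 7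
        * C S) := by
  refine h.hasEulerRep_succ h.hasEulerRep_eight ?_ ?_ ?_ <;>
    simp only [derivative_add, derivative_sub, derivative_neg, derivative_mul, derivative_X,
      derivative_C, derivative_pow, derivative_ofNat, derivative_one, derivative_zero,
      Nat.cast_ofNat, map_ofNat C]
  · linear_combination (-89424 * X ^ 2 - 39168 * X ^ 3 * C y + (500 * C e + 2448 * C y ^ 2) * X ^ 4
      + (3596 + 286 * C y * C e - 162 * C y ^ 3) * X ^ 5 - (2 * C e ^ 2 - 1834 * C y - 18 * C y ^ 2
      * C e) * X ^ 6 - (4 * C e + C y * C e ^ 2 - 18 * C y ^ 2) * X ^ 7 - (2 + 2 * C y * C e) * X ^ 8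
      - X ^ 9 * C y) * h.C_rel_A + (46800 * X ^ 3 + (4500 * C S - 2052 * C y + 918 * C A) * X ^ 4 + (18
      * C e + 2574 * C y * C S - 108 * C y ^ 2 + 567 * C A * C y) * X ^ 5 - (1762 + 18 * C S * C e
      - 9 * C y * C e - 162 * C y ^ 2 * C S + 54 * C y ^ 3 - 54 * C A * C y ^ 2) * X ^ 6 - (36 * C S
      + 9 * C y * C S * C e) * X ^ 7 - 18 * X ^ 8 * C y * C S + X ^ 9) * h.C_rel_e
  · linear_combination (-44712 * X ^ 2 + 2772 * X ^ 3 * C y + (250 * C e - 162 * C y ^ 2) * X ^ 4 + (1798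
      + 18 * C y * C e) * X ^ 5 - (C e ^ 2 - 18 * C y) * X ^ 6 - 2 * X ^ 7 * C e - X ^ 8) * h.C_rel_A
      + (1044 * X ^ 3 + (2250 * C S - 162 * C y + 459 * C A) * X ^ 4 + (9 * C e + 162 * C y * C S - 54
      * C y ^ 2 + 54 * C A * C y) * X ^ 5 + (18 - 9 * C S * C e) * X ^ 6 - 18 * X ^ 7 * C S) * h.C_rel_e
  · linear_combination (8184 * X ^ 2 - 924 * X ^ 3 * C y - (51 * C e - 54 * C y ^ 2) * X ^ 4 - (114
      + 6 * C y * C e) * X ^ 5 - 6 * X ^ 6 * C y) * h.C_rel_A + (1885 * X ^ 3 - (459 * C S - 45 * C y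
      + 250 * C A) * X ^ 4 - (13 * C e + 54 * C y * C S + 18 * C A * C y) * X ^ 5 - (53 - C A * C e)
      * X ^ 6 + 2 * X ^ 7 * C A) * h.C_rel_e

theorem EulerSystem.pow_nine_mul_L1 {ε : ℝ} (h : EulerSystem U f g y A S e)
    (he : e = ε ^ 2 / 18) {x : ℝ} (hx : x ∈ U) (hx0 : x ≠ 0) :
    x ^ 9 * L1 ε f x = x ^ 9 * (e * (2 * A - y - 6 * S) / 12 * f x) := by
  have h2 := h.hasEulerRep_two x hx
  have h3 := h.hasEulerRep_three x hx
  have h4 := h.hasEulerRep_four x hx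
  have h5 := h.hasEulerRep_five x hx
  have h6 := h.hasEulerRep_six x hx
  have h7 := h.hasEulerRep_seven x hx
  have h9 := h.hasEulerRep_nine x hx
  have rel_e := h.rel_e
  simp only [eval_add, eval_sub, eval_neg, eval_mul, eval_pow, eval_X, eval_C, eval_ofNat,
    eval_one] at h2 h3 h4 h5 h6 h7 h9
  obtain ⟨t, ht⟩ : ∃ t, t = x ^ 3 / 18 := ⟨_, rfl⟩
  rw [← ht] at h2 h3 h4 h5 h6 h7 h9
  have hL : x ^ 9 * L1 ε f x = x ^ 9 * iteratedDeriv 9 f x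
      + (-78) * (x ^ 7 * iteratedDeriv 7 f x)
      + (384 + 3 * e * t ^ 2 + 3 * t ^ 3) * (x ^ 6 * iteratedDeriv 6 f x)
      + (-24 + 27 * e * t ^ 2 + 54 * t ^ 3) * (x ^ 5 * iteratedDeriv 5 f x)
      + (-4800 - 48 * e * t ^ 2 + 384 * t ^ 3) * (x ^ 4 * iteratedDeriv 4 f x)
      + (19120 - 429 * e * t ^ 2 + 948 * t ^ 3 + 3 * e ^ 2 * t ^ 4 + 6 * e * t ^ 5 + 3 * t ^ 6) * (x ^ 3 * iteratedDeriv 3 f x)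
      + (-43200 + 624 * e * t ^ 2 - 1752 * t ^ 3 + 27 * e ^ 2 * t ^ 4 + 81 * e * t ^ 5 + 54 * t ^ 6) * (x ^ 2 * iteratedDeriv 2 f x)
      + (58240 + 1320 * e * t ^ 2 - 3648 * t ^ 3 + 30 * e ^ 2 * t ^ 4 + 384 * e * t ^ 5 + 408 * t ^ 6) * (x * deriv f x)
      + (-58240 - 1320 * e * t ^ 2 + 3648 * t ^ 3 - 111 * e ^ 2 * t ^ 4 + 345 * e * t ^ 5 + 888 * t ^ 6 + e ^ 3 * t ^ 6 + 3 * e ^ 2 * t ^ 7 + 3 * e * t ^ 8 + t ^ 9) * f x := by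
    rw [ht, he, L1, fcoef0, fcoef1, fcoef2, fcoef3, fcoef4, fcoef5, fcoef6, fcoef7,
      iteratedDeriv_one]
    field_simp
    ring
  have hx9 : x ^ 9 = 5832 * t ^ 3 := by rw [ht]; ring
  rw [hL, h2, h3, h4, h5, h6, h7, h9, hx9]
  linear_combination ((2916 * t ^ 3 + 1458 * t ^ 4 * y + 729 * t ^ 5 * y ^ 2) * f x
    + 729 * t ^ 4 * y * (x * deriv f x) + (243 * t ^ 4 * y + 27 * t ^ 5 * e) * g x) * rel_e

end EulerSystem

theorem kappa_eq {ε x z : ℝ} (hε : ε ≠ 0) (hz : z ≠ 0) :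
    kappa ε x z = ε ^ 2 * z ^ 3 * (1 + 18 * (z ^ 3 - 1) / (ε ^ 2 * z ^ 3) * (x ^ 3 / 18)) := by
  rw [kappa]
  field_simp
  ring

/-- any solution of the third-order ODE ψ‴ = χ₂ψ″ + χ₁ψ′ + χ₀ψ on U
    is an eigenfunction of L₁ with eigenvalue λ(z) = (1 + w(z))/(2z³) − 1/2. -/
theorem L1_eigenfunction (ε : ℝ) (hε : ε < 0) (z : ℝ) (hz : z ≠ 0)
    (hrad : 0 ≤ 1 - 2 * z ^ 3 - (ε ^ 4 / 3888) * z ^ 4 + z ^ 6)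
    (U : Set ℝ) (hUopen : IsOpen U) (hUpos : U ⊆ {x : ℝ | 0 < x})
    (hκ : ∀ x ∈ U, kappa ε x z ≠ 0)
    (f : ℝ → ℝ) (hf : ContDiffOn ℝ (⊤ : ℕ∞) f U)
    (hode : ∀ x ∈ U, iteratedDeriv 3 f x =
      chi2 ε x z * iteratedDeriv 2 f x + chi1 ε x z * deriv f x + chi0 ε x z * f x) :
    ∀ x ∈ U, L1 ε f x = ((1 + wfun ε z) / (2 * z ^ 3) - 1 / 2) * f x := by
  have hε0 : ε ≠ 0 := hε.ne
  have hw : wfun ε z ^ 2 = 1 - 2 * z ^ 3 - (ε ^ 4 / 3888) * z ^ 4 + z ^ 6 := Real.sq_sqrt hrad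
  have hsys := eulerSystem_of_ode (y := 1 / z) (e := ε ^ 2 / 18)
    (A := (108 * wfun ε z + ε ^ 2 * z ^ 2) / (2 * ε ^ 2 * z ^ 3))
    (S := 18 * (z ^ 3 - 1) / (ε ^ 2 * z ^ 3)) hUopen hf ?_ ?_ ?_ ?_ rfl
  · intro x hx
    have hx0 : x ≠ 0 := (hUpos hx).ne'
    refine mul_left_cancel₀ (pow_ne_zero 9 hx0) ((hsys.pow_nine_mul_L1 rfl hx hx0).trans ?_)
    field_simp
    ring
  · field_simp
    linear_combination 11664 * hw
  · field_simp
  · intro x hx h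
    exact hκ x hx (by rw [kappa_eq hε0 hz, h, mul_zero])
  · rintro x hx t rfl
    have hx0 : x ≠ 0 := (hUpos hx).ne'
    have hk := hκ x hx
    rw [hode x hx, chi0, chi1, chi2]
    have hK : 1 + 18 * (z ^ 3 - 1) / (ε ^ 2 * z ^ 3) * (x ^ 3 / 18)
        = kappa ε x z / (ε ^ 2 * z ^ 3) := by
      rw [kappa_eq hε0 hz]
      field_simp
    rw [hK]
    field_simp
    rw [kappa]
    ring
end

section
/- Fix a real parameter ε. The 9th-order operator L₁ and the 12th-order operator L₂ with the rational coefficients given below commute: for every infinitely differentiable function f on the open set U = {x ∈ ℝ : x ≠ 0} and every x ∈ U, (L₁(L₂f))(x) = (L₂(L₁f))(x). -/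
/-- Coefficients of the 12th-order operator L₂ (equation (2.19) of the paper). -/
noncomputable def gcoef10 (ε x : ℝ) : ℝ := -104 / x ^ 2

noncomputable def gcoef9 (ε x : ℝ) : ℝ :=
  824 / x ^ 3 + ε ^ 2 * x ^ 3 / 1458 + x ^ 6 / 1458

noncomputable def gcoef8 (ε x : ℝ) : ℝ :=
  -2856 / x ^ 4 + ε ^ 2 * x ^ 2 / 108 + x ^ 5 / 54

noncomputable def gcoef7 (ε x : ℝ) : ℝ :=
  -672 / x ^ 5 + ε ^ 2 * x / 486 + 109 * x ^ 4 / 486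

noncomputable def gcoef6 (ε x : ℝ) : ℝ :=
  -167 * ε ^ 2 / 972 + 86464 / x ^ 6 + 316 * x ^ 3 / 243
    + ε ^ 4 * x ^ 6 / 5668704 + ε ^ 2 * x ^ 9 / 2834352 + x ^ 12 / 5668704

noncomputable def gcoef5 (ε x : ℝ) : ℝ :=
  -693504 / x ^ 7 - 13 * ε ^ 2 / (243 * x) + 221 * x ^ 2 / 243
    + ε ^ 4 * x ^ 5 / 314928 + ε ^ 2 * x ^ 8 / 104976 + x ^ 11 / 157464

noncomputable def gcoef4 (ε x : ℝ) : ℝ :=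
  3395840 / x ^ 8 + 271 * ε ^ 2 / (243 * x ^ 2) - 2834 * x / 243
    + 193 * ε ^ 4 * x ^ 4 / 11337408 + 317 * ε ^ 2 * x ^ 7 / 2834352
    + 307 * x ^ 10 / 2834352

noncomputable def gcoef3 (ε x : ℝ) : ℝ :=
  -5992 / 729 - 11567360 / x ^ 9 + 1028 * ε ^ 2 / (729 * x ^ 3)
    + 25 * ε ^ 4 * x ^ 3 / 1417176 + 457 * ε ^ 2 * x ^ 6 / 708588
    + 1393 * x ^ 9 / 1417176 + ε ^ 6 * x ^ 9 / 49589822592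
    + ε ^ 4 * x ^ 12 / 16529940864 + ε ^ 2 * x ^ 15 / 16529940864
    + x ^ 18 / 49589822592

noncomputable def gcoef2 (ε x : ℝ) : ℝ :=
  27758080 / x ^ 10 - 182 * ε ^ 2 / (27 * x ^ 4) + 296 / (9 * x)
    - 413 * ε ^ 4 * x ^ 2 / 5668704 + 4339 * ε ^ 2 * x ^ 5 / 2834352
    + 6595 * x ^ 8 / 1417176 + ε ^ 6 * x ^ 8 / 3673320192
    + ε ^ 4 * x ^ 11 / 918330048 + 5 * ε ^ 2 * x ^ 14 / 3673320192
    + x ^ 17 / 1836660096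

noncomputable def gcoef1 (ε x : ℝ) : ℝ :=
  -45660160 / x ^ 11 + 4928 * ε ^ 2 / (729 * x ^ 5) + 20048 / (729 * x ^ 2)
    - 203 * ε ^ 4 * x / 2834352 + 1691 * ε ^ 2 * x ^ 4 / 2834352
    + 7111 * x ^ 7 / 708588 + 55 * ε ^ 6 * x ^ 7 / 49589822592
    + 127 * ε ^ 4 * x ^ 10 / 16529940864 + 217 * ε ^ 2 * x ^ 13 / 16529940864
    + 325 * x ^ 16 / 49589822592

noncomputable def gcoef0 (ε x : ℝ) : ℝ :=
  45660160 / x ^ 12 - 4928 * ε ^ 2 / (729 * x ^ 6) - 20048 / (729 * x ^ 3)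
    - 605 * ε ^ 2 * x ^ 3 / 708588 + 4553 * x ^ 6 / 708588
    + 79 * ε ^ 6 * x ^ 6 / 99179645184 + 269 * ε ^ 4 * x ^ 9 / 16529940864
    + 683 * ε ^ 2 * x ^ 12 / 16529940864 + ε ^ 8 * x ^ 12 / 1156831381426176
    + 661 * x ^ 15 / 24794911296 + ε ^ 6 * x ^ 15 / 289207845356544
    + ε ^ 4 * x ^ 18 / 192805230237696 + ε ^ 2 * x ^ 21 / 289207845356544
    + x ^ 24 / 1156831381426176

/-- The 12th-order operator L₂ of the paper. -/
noncomputable def L2 (ε : ℝ) (f : ℝ → ℝ) (x : ℝ) : ℝ :=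
  iteratedDeriv 12 f x
    + gcoef10 ε x * iteratedDeriv 10 f x
    + gcoef9 ε x * iteratedDeriv 9 f x
    + gcoef8 ε x * iteratedDeriv 8 f x
    + gcoef7 ε x * iteratedDeriv 7 f x
    + gcoef6 ε x * iteratedDeriv 6 f x
    + gcoef5 ε x * iteratedDeriv 5 f x
    + gcoef4 ε x * iteratedDeriv 4 f x
    + gcoef3 ε x * iteratedDeriv 3 f x
    + gcoef2 ε x * iteratedDeriv 2 f x
    + gcoef1 ε x * iteratedDeriv 1 f x
    + gcoef0 ε x * f x

section DifferentialOperators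

open Set Filter Topology
open scoped ContDiff

/-- The linear differential operator `f ↦ ∑ i, a i * f⁽ⁱ⁾`. -/
noncomputable def diffOp {n : ℕ} (a : Fin n → ℝ → ℝ) (f : ℝ → ℝ) (x : ℝ) : ℝ :=
  ∑ i, a i x * iteratedDeriv i f x

variable {U : Set ℝ} {m n : ℕ} {a : Fin m → ℝ → ℝ} {b : Fin n → ℝ → ℝ} {f g : ℝ → ℝ} {x : ℝ}

theorem ContDiffOn.iteratedDeriv_of_isOpen (hU : IsOpen U) (hf : ContDiffOn ℝ ∞ f U) (k : ℕ) :
    ContDiffOn ℝ ∞ (iteratedDeriv k f) U := by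
  induction k with
  | zero => simpa using hf
  | succ k ih =>
    rw [iteratedDeriv_succ]
    exact ih.deriv_of_isOpen hU (by simp)

theorem ContDiffOn.contDiffAt_nat (hU : IsOpen U) (hf : ContDiffOn ℝ ∞ f U) (hx : x ∈ U) (k : ℕ) :
    ContDiffAt ℝ k f x :=
  (hf.contDiffAt (hU.mem_nhds hx)).of_le (by exact_mod_cast le_top)

theorem ContDiffOn.diffOp (hU : IsOpen U) (ha : ∀ i, ContDiffOn ℝ ∞ (a i) U)
    (hf : ContDiffOn ℝ ∞ f U) : ContDiffOn ℝ ∞ (diffOp a f) U :=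
  ContDiffOn.sum fun i _ => (ha i).mul (hf.iteratedDeriv_of_isOpen hU i)

theorem diffOp_congr (hU : IsOpen U) (h : EqOn f g U) (hx : x ∈ U) :
    diffOp a f x = diffOp a g x := by
  simp only [diffOp, h.iteratedDeriv_of_isOpen hU _ hx]

theorem diffOp_sum (hU : IsOpen U) {ι : Type*} (s : Finset ι) (c : ι → ℝ) (u : ι → ℝ → ℝ)
    (hu : ∀ i ∈ s, ContDiffOn ℝ ∞ (u i) U) (hx : x ∈ U) :
    diffOp a (fun y => ∑ i ∈ s, c i * u i y) x = ∑ i ∈ s, c i * diffOp a (u i) x := by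
  have key (k : ℕ) : iteratedDeriv k (fun y => ∑ i ∈ s, c i * u i y) x =
      ∑ i ∈ s, c i * iteratedDeriv k (u i) x := by
    rw [iteratedDeriv_fun_sum fun i hi =>
      contDiffAt_const.mul ((hu i hi).contDiffAt_nat hU hx k)]
    simp only [iteratedDeriv_const_mul_field]
  simp only [diffOp, key, Finset.mul_sum]
  rw [Finset.sum_comm]
  exact Finset.sum_congr rfl fun i _ => Finset.sum_congr rfl fun j _ => by ring

/-- The functionals on smooth functions that are linear combinations of derivatives at `x`. -/
def jetFunctionals (U : Set ℝ) (x : ℝ) : Submodule ℝ ({f : ℝ → ℝ // ContDiffOn ℝ ∞ f U} → ℝ) :=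
  Submodule.span ℝ (range fun k f => iteratedDeriv k f.1 x)

theorem iteratedDeriv_mul_mem_jetFunctionals (hU : IsOpen U) (hx : x ∈ U) {c : ℝ → ℝ}
    (hc : ContDiffOn ℝ ∞ c U) (k j : ℕ) :
    (fun f => iteratedDeriv k (fun y => c y * iteratedDeriv j f.1 y) x) ∈ jetFunctionals U x := by
  have key : (fun f : {f : ℝ → ℝ // ContDiffOn ℝ ∞ f U} =>
      iteratedDeriv k (fun y => c y * iteratedDeriv j f.1 y) x) =
      ∑ i ∈ Finset.range (k + 1), (k.choose i * iteratedDeriv i c x) •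
        fun f => iteratedDeriv (k - i + j) f.1 x := by
    ext f
    rw [iteratedDeriv_fun_mul (hc.contDiffAt_nat hU hx k)
      ((f.2.iteratedDeriv_of_isOpen hU j).contDiffAt_nat hU hx k)]
    simp [iteratedDeriv_eq_iterate, Function.iterate_add_apply]
  rw [key]
  exact Submodule.sum_mem _ fun i _ => Submodule.smul_mem _ _ (Submodule.subset_span ⟨_, rfl⟩)

theorem diffOp_diffOp_mem_jetFunctionals (hU : IsOpen U) (hx : x ∈ U)
    (hb : ∀ i, ContDiffOn ℝ ∞ (b i) U) :
    (fun f => diffOp a (diffOp b f.1) x) ∈ jetFunctionals U x := by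
  have key : (fun f : {f : ℝ → ℝ // ContDiffOn ℝ ∞ f U} => diffOp a (diffOp b f.1) x) =
      ∑ i, a i x • ∑ j, fun f => iteratedDeriv i (fun y => b j y * iteratedDeriv j f.1 y) x := by
    ext f
    simp only [diffOp, Finset.sum_apply, Pi.smul_apply, smul_eq_mul]
    refine Finset.sum_congr rfl fun i _ => ?_
    congr 1
    exact iteratedDeriv_fun_sum fun j _ =>
      ((hb j).contDiffAt_nat hU hx i).mul
        ((f.2.iteratedDeriv_of_isOpen hU j).contDiffAt_nat hU hx i)
  rw [key]
  exact Submodule.sum_mem _ fun i _ => Submodule.smul_mem _ _ <| Submodule.sum_mem _ fun j _ =>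
    iteratedDeriv_mul_mem_jetFunctionals hU hx (hb j) i j

/-- A jet functional is determined by its values on monomials. -/
theorem eq_zero_of_mem_jetFunctionals {F : {f : ℝ → ℝ // ContDiffOn ℝ ∞ f U} → ℝ}
    (hF : F ∈ jetFunctionals U x)
    (h : ∀ k : ℕ, F ⟨fun y => y ^ k, (contDiff_id.pow k).contDiffOn⟩ = 0) : F = 0 := by
  obtain ⟨c, rfl⟩ := Finsupp.mem_span_range_iff_exists_finsupp.1 hF
  suffices c = 0 by simp [this]
  ext k
  induction k using Nat.strong_induction_on with
  | _ k ih =>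
    have hk := h k
    simp only [Finsupp.sum, Finset.sum_apply, Pi.smul_apply, smul_eq_mul, iteratedDeriv_pow] at hk
    rw [Finset.sum_eq_single k] at hk
    · simpa [Nat.descFactorial_self, Nat.factorial_ne_zero] using hk
    · intro j _ hj
      rcases lt_or_gt_of_ne hj with hj | hj
      · simp [ih j hj]
      · simp [Nat.descFactorial_eq_zero_iff_lt.2 hj]
    · intro hk
      simp [Finsupp.notMem_support_iff.1 hk]

/-- Differential operators that commute on monomials commute on all smooth functions. -/
theorem diffOp_comm_of_monomials (hU : IsOpen U) (ha : ∀ i, ContDiffOn ℝ ∞ (a i) U)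
    (hb : ∀ i, ContDiffOn ℝ ∞ (b i) U) (hf : ContDiffOn ℝ ∞ f U) (hx : x ∈ U)
    (h : ∀ k : ℕ, diffOp a (diffOp b (· ^ k)) x = diffOp b (diffOp a (· ^ k)) x) :
    diffOp a (diffOp b f) x = diffOp b (diffOp a f) x := by
  have key := eq_zero_of_mem_jetFunctionals
    (Submodule.sub_mem _ (diffOp_diffOp_mem_jetFunctionals (a := a) hU hx hb)
      (diffOp_diffOp_mem_jetFunctionals (a := b) hU hx ha)) fun k => sub_eq_zero.2 (h k)
  exact sub_eq_zero.1 (congrFun key ⟨f, hf⟩)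

end DifferentialOperators

section Commutation

open Set
open scoped ContDiff

/-- The coefficients of `L₁`. -/
noncomputable def L1Coeff (ε : ℝ) : Fin 10 → ℝ → ℝ :=
  ![fcoef0 ε, fcoef1 ε, fcoef2 ε, fcoef3 ε, fcoef4 ε, fcoef5 ε, fcoef6 ε, fcoef7 ε,
    fun _ => 0, fun _ => 1]

/-- The coefficients of `L₂`. -/
noncomputable def L2Coeff (ε : ℝ) : Fin 13 → ℝ → ℝ :=
  ![gcoef0 ε, gcoef1 ε, gcoef2 ε, gcoef3 ε, gcoef4 ε, gcoef5 ε, gcoef6 ε, gcoef7 ε, gcoef8 ε,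
    gcoef9 ε, gcoef10 ε, fun _ => 0, fun _ => 1]

theorem L1_eq_diffOp (ε : ℝ) : L1 ε = diffOp (L1Coeff ε) := by
  ext f x
  simp [L1, diffOp, L1Coeff, Fin.sum_univ_succ]
  ring

theorem L2_eq_diffOp (ε : ℝ) : L2 ε = diffOp (L2Coeff ε) := by
  ext f x
  simp [L2, diffOp, L2Coeff, Fin.sum_univ_succ]
  ring

theorem contDiffOn_L1Coeff (ε : ℝ) (i : Fin 10) : ContDiffOn ℝ ∞ (L1Coeff ε i) {x | x ≠ 0} := by
  intro x (hx : x ≠ 0)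
  apply ContDiffAt.contDiffWithinAt
  fin_cases i <;> simp only [L1Coeff, Fin.reduceFinMk, Matrix.cons_val, Fin.mk_one,
    Fin.zero_eta] <;>
    first
    | exact contDiffAt_const
    | simp only [
      funext (fcoef0.eq_1 ε), funext (fcoef1.eq_1 ε), funext (fcoef2.eq_1 ε),
      funext (fcoef3.eq_1 ε), funext (fcoef4.eq_1 ε), funext (fcoef5.eq_1 ε),
      funext (fcoef6.eq_1 ε), funext (fcoef7.eq_1 ε)]
      fun_prop (disch := simp [hx])

theorem contDiffOn_L2Coeff (ε : ℝ) (i : Fin 13) : ContDiffOn ℝ ∞ (L2Coeff ε i) {x | x ≠ 0} := by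
  intro x (hx : x ≠ 0)
  apply ContDiffAt.contDiffWithinAt
  fin_cases i <;> simp only [L2Coeff, Fin.reduceFinMk, Matrix.cons_val, Fin.mk_one,
    Fin.zero_eta] <;>
    first
    | exact contDiffAt_const
    | simp only [
      funext (gcoef0.eq_1 ε), funext (gcoef1.eq_1 ε), funext (gcoef2.eq_1 ε),
      funext (gcoef3.eq_1 ε), funext (gcoef4.eq_1 ε), funext (gcoef5.eq_1 ε),
      funext (gcoef6.eq_1 ε), funext (gcoef7.eq_1 ε), funext (gcoef8.eq_1 ε),
      funext (gcoef9.eq_1 ε), funext (gcoef10.eq_1 ε)]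
      fun_prop (disch := simp [hx])

/-- The falling factorial `s (s - 1) ⋯ (s - k + 1)`. -/
noncomputable def fallingProd (s : ℝ) (k : ℕ) : ℝ := ∏ i ∈ Finset.range k, (s - i)

theorem iteratedDeriv_zpow_eq_fallingProd (s : ℤ) (k : ℕ) {x : ℝ} (hx : x ≠ 0) :
    iteratedDeriv k (fun y : ℝ => y ^ s) x = fallingProd s k * (x ^ s / x ^ k) := by
  rw [iteratedDeriv_eq_iterate, iter_deriv_zpow, zpow_sub₀ hx, zpow_natCast, fallingProd]

/-- `L1Symbol ε s k` is the coefficient of `x ^ (s + 3k - 9)` in `L₁ (x ^ s)`. -/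
noncomputable def L1Symbol (ε s : ℝ) : ℕ → ℝ
  | 0 =>
    fallingProd s 9 - 78 * fallingProd s 7 + 384 * fallingProd s 6 - 24 * fallingProd s 5
      - 4800 * fallingProd s 4 + 19120 * fallingProd s 3 - 43200 * fallingProd s 2
      + 58240 * fallingProd s 1 - 58240
  | 1 => 0
  | 2 =>
    ε ^ 2 * fallingProd s 6 / 1944 + ε ^ 2 * fallingProd s 5 / 216
      - 2 * ε ^ 2 * fallingProd s 4 / 243 - 143 * ε ^ 2 * fallingProd s 3 / 1944
      + 26 * ε ^ 2 * fallingProd s 2 / 243 + 55 * ε ^ 2 * fallingProd s 1 / 243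
      - 55 * ε ^ 2 / 243
  | 3 =>
    fallingProd s 6 / 1944 + fallingProd s 5 / 108 + 16 * fallingProd s 4 / 243
      + 79 * fallingProd s 3 / 486 - 73 * fallingProd s 2 / 243 - 152 * fallingProd s 1 / 243
      + 152 / 243
  | 4 =>
    ε ^ 4 * fallingProd s 3 / 11337408 + ε ^ 4 * fallingProd s 2 / 1259712
      + 5 * ε ^ 4 * fallingProd s 1 / 5668704 - 37 * ε ^ 4 / 11337408
  | 5 =>
    ε ^ 2 * fallingProd s 3 / 5668704 + ε ^ 2 * fallingProd s 2 / 419904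
      + 2 * ε ^ 2 * fallingProd s 1 / 177147 + 115 * ε ^ 2 / 11337408
  | 6 =>
    fallingProd s 3 / 11337408 + fallingProd s 2 / 629856 + 17 * fallingProd s 1 / 1417176
      + 37 / 1417176 + ε ^ 6 / 198359290368
  | 7 =>
    ε ^ 4 / 66119763456
  | 8 =>
    ε ^ 2 / 66119763456
  | 9 =>
    1 / 198359290368
  | _ => 0

/-- `L2Symbol ε s k` is the coefficient of `x ^ (s + 3k - 12)` in `L₂ (x ^ s)`. -/
noncomputable def L2Symbol (ε s : ℝ) : ℕ → ℝ
  | 0 =>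
    fallingProd s 12 - 104 * fallingProd s 10 + 824 * fallingProd s 9 - 2856 * fallingProd s 8
      - 672 * fallingProd s 7 + 86464 * fallingProd s 6 - 693504 * fallingProd s 5
      + 3395840 * fallingProd s 4 - 11567360 * fallingProd s 3 + 27758080 * fallingProd s 2
      - 45660160 * fallingProd s 1 + 45660160
  | 1 => 0
  | 2 =>
    ε ^ 2 * fallingProd s 9 / 1458 + ε ^ 2 * fallingProd s 8 / 108
      + ε ^ 2 * fallingProd s 7 / 486 - 167 * ε ^ 2 * fallingProd s 6 / 972
      - 13 * ε ^ 2 * fallingProd s 5 / 243 + 271 * ε ^ 2 * fallingProd s 4 / 243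
      + 1028 * ε ^ 2 * fallingProd s 3 / 729 - 182 * ε ^ 2 * fallingProd s 2 / 27
      + 4928 * ε ^ 2 * fallingProd s 1 / 729 - 4928 * ε ^ 2 / 729
  | 3 =>
    fallingProd s 9 / 1458 + fallingProd s 8 / 54 + 109 * fallingProd s 7 / 486
      + 316 * fallingProd s 6 / 243 + 221 * fallingProd s 5 / 243 - 2834 * fallingProd s 4 / 243
      - 5992 * fallingProd s 3 / 729 + 296 * fallingProd s 2 / 9 + 20048 * fallingProd s 1 / 729
      - 20048 / 729
  | 4 =>
    ε ^ 4 * fallingProd s 6 / 5668704 + ε ^ 4 * fallingProd s 5 / 314928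
      + 193 * ε ^ 4 * fallingProd s 4 / 11337408 + 25 * ε ^ 4 * fallingProd s 3 / 1417176
      - 413 * ε ^ 4 * fallingProd s 2 / 5668704 - 203 * ε ^ 4 * fallingProd s 1 / 2834352
  | 5 =>
    ε ^ 2 * fallingProd s 6 / 2834352 + ε ^ 2 * fallingProd s 5 / 104976
      + 317 * ε ^ 2 * fallingProd s 4 / 2834352 + 457 * ε ^ 2 * fallingProd s 3 / 708588
      + 4339 * ε ^ 2 * fallingProd s 2 / 2834352 + 1691 * ε ^ 2 * fallingProd s 1 / 2834352
      - 605 * ε ^ 2 / 708588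
  | 6 =>
    fallingProd s 6 / 5668704 + fallingProd s 5 / 157464 + 307 * fallingProd s 4 / 2834352
      + 1393 * fallingProd s 3 / 1417176 + ε ^ 6 * fallingProd s 3 / 49589822592
      + 6595 * fallingProd s 2 / 1417176 + ε ^ 6 * fallingProd s 2 / 3673320192
      + 7111 * fallingProd s 1 / 708588 + 55 * ε ^ 6 * fallingProd s 1 / 49589822592
      + 4553 / 708588 + 79 * ε ^ 6 / 99179645184
  | 7 =>
    ε ^ 4 * fallingProd s 3 / 16529940864 + ε ^ 4 * fallingProd s 2 / 918330048
      + 127 * ε ^ 4 * fallingProd s 1 / 16529940864 + 269 * ε ^ 4 / 16529940864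
  | 8 =>
    ε ^ 2 * fallingProd s 3 / 16529940864 + 5 * ε ^ 2 * fallingProd s 2 / 3673320192
      + 217 * ε ^ 2 * fallingProd s 1 / 16529940864 + 683 * ε ^ 2 / 16529940864
      + ε ^ 8 / 1156831381426176
  | 9 =>
    fallingProd s 3 / 49589822592 + fallingProd s 2 / 1836660096
      + 325 * fallingProd s 1 / 49589822592 + 661 / 24794911296 + ε ^ 6 / 289207845356544
  | 10 =>
    ε ^ 4 / 192805230237696
  | 11 =>
    ε ^ 2 / 289207845356544
  | 12 =>
    1 / 1156831381426176
  | _ => 0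

theorem L1_zpow (ε : ℝ) (s : ℤ) {x : ℝ} (hx : x ≠ 0) :
    L1 ε (fun y => y ^ s) x =
      ∑ k ∈ Finset.range 10, L1Symbol ε s k * x ^ (s + (3 * k - 9 : ℤ)) := by
  have hs : x ^ s ≠ 0 := zpow_ne_zero _ hx
  simp only [L1, iteratedDeriv_zpow_eq_fallingProd s _ hx, Finset.sum_range_succ, L1Symbol,
    zpow_add₀ hx, fcoef0, fcoef1, fcoef2, fcoef3, fcoef4, fcoef5, fcoef6, fcoef7]
  norm_num [zpow_neg, zpow_ofNat]
  field_simp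
  ring

theorem L2_zpow (ε : ℝ) (s : ℤ) {x : ℝ} (hx : x ≠ 0) :
    L2 ε (fun y => y ^ s) x =
      ∑ k ∈ Finset.range 13, L2Symbol ε s k * x ^ (s + (3 * k - 12 : ℤ)) := by
  have hs : x ^ s ≠ 0 := zpow_ne_zero _ hx
  simp only [L2, iteratedDeriv_zpow_eq_fallingProd s _ hx, Finset.sum_range_succ, L2Symbol,
    zpow_add₀ hx, gcoef0, gcoef1, gcoef2, gcoef3, gcoef4, gcoef5, gcoef6, gcoef7, gcoef8, gcoef9,
    gcoef10]
  norm_num [zpow_neg, zpow_ofNat]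
  field_simp
  ring

set_option maxHeartbeats 4000000 in
theorem symbol_comm (ε s : ℝ) {n : ℕ} (hn : n < 23) :
    ∑ p ∈ Finset.HasAntidiagonal.antidiagonal n,
        L2Symbol ε s p.1 * L1Symbol ε (s + (3 * p.1 - 12)) p.2 =
      ∑ p ∈ Finset.HasAntidiagonal.antidiagonal n,
        L1Symbol ε s p.2 * L2Symbol ε (s + (3 * p.2 - 9)) p.1 := by
  simp only [Finset.Nat.sum_antidiagonal_eq_sum_range_succ_mk]
  interval_cases n <;>
  · simp only [Finset.sum_range_succ, Finset.sum_range_zero, L1Symbol, L2Symbol, fallingProd,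
      Finset.prod_range_succ, Finset.prod_range_zero, Nat.reduceSub, Nat.cast_zero, Nat.cast_one,
      Nat.cast_ofNat]
    ring

/-- Collecting a double sum along its antidiagonals. -/
theorem sum_range_range_mul_add {M N : ℕ} (A : ℕ → ℕ → ℝ) (z : ℕ → ℝ)
    (hM : ∀ i k, M ≤ i → A i k = 0) (hN : ∀ i k, N ≤ k → A i k = 0) :
    ∑ i ∈ Finset.range M, ∑ k ∈ Finset.range N, A i k * z (i + k) =
      ∑ n ∈ Finset.range (M + N),
        (∑ p ∈ Finset.HasAntidiagonal.antidiagonal n, A p.1 p.2) * z n := by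
  rw [← Finset.sum_product', ← Finset.sum_fiberwise_of_maps_to (g := fun p => p.1 + p.2)
    (t := Finset.range (M + N)) (by simp; lia)]
  refine Finset.sum_congr rfl fun n _ => ?_
  rw [Finset.sum_mul]
  refine Finset.sum_subset_zero_on_sdiff (fun p hp => by simp_all) ?_ fun p hp => ?_
  · intro p hp
    simp only [Finset.mem_sdiff, Finset.HasAntidiagonal.mem_antidiagonal, Finset.mem_filter,
      Finset.mem_product, Finset.mem_range, not_and] at hp
    rcases le_or_gt M p.1 with h | h
    · simp [hM _ _ h]
    · rw [hN _ _ (not_lt.1 fun h' => hp.2 ⟨h, h'⟩ hp.1), zero_mul]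
  · rw [(Finset.mem_filter.1 hp).2]

theorem L1Symbol_eq_zero (ε s : ℝ) {k : ℕ} (hk : 10 ≤ k) : L1Symbol ε s k = 0 := by
  obtain ⟨k, rfl⟩ := Nat.exists_eq_add_of_le' hk
  rfl

theorem L2Symbol_eq_zero (ε s : ℝ) {k : ℕ} (hk : 13 ≤ k) : L2Symbol ε s k = 0 := by
  obtain ⟨k, rfl⟩ := Nat.exists_eq_add_of_le' hk
  rfl

theorem L1_L2_zpow (ε : ℝ) (s : ℤ) {x : ℝ} (hx : x ≠ 0) :
    L1 ε (L2 ε fun y => y ^ s) x = L2 ε (L1 ε fun y => y ^ s) x := by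
  have hU : IsOpen {x : ℝ | x ≠ 0} := isOpen_ne
  have hpow (t : ℤ) : ContDiffOn ℝ ∞ (fun y : ℝ => y ^ t) {x | x ≠ 0} := fun y hy =>
    (analyticAt_id.zpow hy).contDiffAt.contDiffWithinAt
  have h1 : L1 ε (L2 ε fun y => y ^ s) x = ∑ i ∈ Finset.range 13, ∑ k ∈ Finset.range 10,
      L2Symbol ε s i * L1Symbol ε (s + (3 * i - 12)) k *
        x ^ (s + (3 * (i + k : ℕ) - 21 : ℤ)) := by
    rw [L1_eq_diffOp, diffOp_congr hU (fun y hy => L2_zpow ε s hy) hx,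
      diffOp_sum hU _ _ _ (fun _ _ => hpow _) hx]
    refine Finset.sum_congr rfl fun i _ => ?_
    rw [← L1_eq_diffOp, L1_zpow ε _ hx, Finset.mul_sum]
    refine Finset.sum_congr rfl fun k _ => ?_
    push_cast
    rw [mul_assoc]
    ring_nf
  have h2 : L2 ε (L1 ε fun y => y ^ s) x = ∑ i ∈ Finset.range 13, ∑ k ∈ Finset.range 10,
      L1Symbol ε s k * L2Symbol ε (s + (3 * k - 9)) i *
        x ^ (s + (3 * (i + k : ℕ) - 21 : ℤ)) := by
    rw [L2_eq_diffOp, diffOp_congr hU (fun y hy => L1_zpow ε s hy) hx,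
      diffOp_sum hU _ _ _ (fun _ _ => hpow _) hx, Finset.sum_comm]
    refine Finset.sum_congr rfl fun i _ => ?_
    rw [← L2_eq_diffOp, L2_zpow ε _ hx, Finset.mul_sum]
    refine Finset.sum_congr rfl fun k _ => ?_
    push_cast
    rw [mul_assoc]
    ring_nf
  rw [h1, h2,
    sum_range_range_mul_add (fun i k => L2Symbol ε s i * L1Symbol ε (s + (3 * i - 12)) k)
      (fun n => x ^ (s + (3 * n - 21 : ℤ)))
      (fun i k hi => by simp [L2Symbol_eq_zero _ _ hi])
      (fun i k hk => by simp [L1Symbol_eq_zero _ _ hk]),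
    sum_range_range_mul_add (fun i k => L1Symbol ε s k * L2Symbol ε (s + (3 * k - 9)) i)
      (fun n => x ^ (s + (3 * n - 21 : ℤ)))
      (fun i k hi => by simp [L2Symbol_eq_zero _ _ hi])
      (fun i k hk => by simp [L1Symbol_eq_zero _ _ hk])]
  refine Finset.sum_congr rfl fun n hn => ?_
  rw [symbol_comm ε s (Finset.mem_range.1 hn)]

end Commutation

/-- the operators L₁ and L₂ commute on smooth functions on ℝ \ {0}. -/
theorem L1_L2_commute (ε : ℝ) (f : ℝ → ℝ)
    (hf : ContDiffOn ℝ (⊤ : ℕ∞) f {x : ℝ | x ≠ 0}) :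
    ∀ x : ℝ, x ≠ 0 → L1 ε (L2 ε f) x = L2 ε (L1 ε f) x := by
  intro x hx
  have hU : IsOpen {x : ℝ | x ≠ 0} := isOpen_ne
  rw [L1_eq_diffOp, L2_eq_diffOp]
  refine diffOp_comm_of_monomials hU (contDiffOn_L1Coeff ε) (contDiffOn_L2Coeff ε) hf hx fun k => ?_
  simpa [← L1_eq_diffOp, ← L2_eq_diffOp] using L1_L2_zpow ε k hx
end
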